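/- Let Ω ⊆ ℝ² be an open neighborhood of a point z₀ = (s₀, t₀), let V : Ω → ℝ be smooth with V(z₀) > 0, and let u, w : Ω → ℝ be smooth functions satisfying the reduced special Lagrangian system V·∂u/∂s = ∂w/∂t and ∂u/∂t = −∂w/∂s at every point of Ω. Let m ≥ 1, set c = w(z₀), and suppose that all partial derivatives of u of order ≤ m − 1 vanish at z₀, and all partial derivatives of w − c of order ≤ m − 1 vanish at z₀. Let p, q : ℝ² → ℝ be the degree-m homogeneous Taylor polynomials of u and of w − c at z₀, i.e. p(ξ, η) = Σ_{j+k=m} (∂^m u/∂s^j ∂t^k)(z₀)·ξ^j·η^k/(j!·k!) and similarly for q. Then V(z₀)·∂p/∂ξ = ∂q/∂η and ∂p/∂η = −∂q/∂ξ hold identically on ℝ²; consequently there exists a complex number c′ such that √(V(z₀))·p(ξ, η) + i·q(ξ, η) = c′·(ξ + i·√(V(z₀))·η)^m for all (ξ, η) ∈ ℝ². -/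

import Mathlib

/-- Partial derivative in the first coordinate direction `s` of `ℝ²`. -/
noncomputable def pd1 (f : ℝ × ℝ → ℝ) : ℝ × ℝ → ℝ := fun p => fderiv ℝ f p (1, 0)

/-- Partial derivative in the second coordinate direction `t` of `ℝ²`. -/
noncomputable def pd2 (f : ℝ × ℝ → ℝ) : ℝ × ℝ → ℝ := fun p => fderiv ℝ f p (0, 1)

/-- The mixed partial derivative `∂^{j+k} f / ∂s^j ∂t^k`. -/
noncomputable def mixedPartial (j k : ℕ) (f : ℝ × ℝ → ℝ) : ℝ × ℝ → ℝ :=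
  pd1^[j] (pd2^[k] f)

section PartialDerivatives

open Set

variable {Ω : Set (ℝ × ℝ)} {f g : ℝ × ℝ → ℝ}

lemma ContDiffOn.fderiv_apply_const (hΩ : IsOpen Ω) (hf : ContDiffOn ℝ (⊤ : ℕ∞) f Ω)
    (v : ℝ × ℝ) : ContDiffOn ℝ (⊤ : ℕ∞) (fun x => fderiv ℝ f x v) Ω :=
  (hf.fderiv_of_isOpen hΩ (m := (⊤ : ℕ∞)) (by simp)).clm_apply contDiffOn_const

lemma ContDiffOn.differentiableAt_of_isOpen (hΩ : IsOpen Ω) (hf : ContDiffOn ℝ (⊤ : ℕ∞) f Ω)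
    {x : ℝ × ℝ} (hx : x ∈ Ω) : DifferentiableAt ℝ f x :=
  (hf.contDiffAt (hΩ.mem_nhds hx)).differentiableAt (by simp)

lemma ContDiffOn.pd1 (hΩ : IsOpen Ω) (hf : ContDiffOn ℝ (⊤ : ℕ∞) f Ω) :
    ContDiffOn ℝ (⊤ : ℕ∞) (pd1 f) Ω :=
  hf.fderiv_apply_const hΩ (1, 0)

lemma ContDiffOn.pd2 (hΩ : IsOpen Ω) (hf : ContDiffOn ℝ (⊤ : ℕ∞) f Ω) :
    ContDiffOn ℝ (⊤ : ℕ∞) (pd2 f) Ω :=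
  hf.fderiv_apply_const hΩ (0, 1)

lemma ContDiffOn.iterate_pd1 (hΩ : IsOpen Ω) (hf : ContDiffOn ℝ (⊤ : ℕ∞) f Ω) (j : ℕ) :
    ContDiffOn ℝ (⊤ : ℕ∞) (_root_.pd1^[j] f) Ω := by
  induction j generalizing f with
  | zero => exact hf
  | succ j ih => exact ih (hf.pd1 hΩ)

lemma ContDiffOn.iterate_pd2 (hΩ : IsOpen Ω) (hf : ContDiffOn ℝ (⊤ : ℕ∞) f Ω) (k : ℕ) :
    ContDiffOn ℝ (⊤ : ℕ∞) (_root_.pd2^[k] f) Ω := by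
  induction k generalizing f with
  | zero => exact hf
  | succ k ih => exact ih (hf.pd2 hΩ)

lemma Set.EqOn.pd1 (hΩ : IsOpen Ω) (h : EqOn f g Ω) :
    EqOn (pd1 f) (pd1 g) Ω := by
  intro _ hx
  simp only [_root_.pd1, (Filter.eventuallyEq_of_mem (hΩ.mem_nhds hx) h).fderiv_eq]

lemma Set.EqOn.pd2 (hΩ : IsOpen Ω) (h : EqOn f g Ω) :
    EqOn (pd2 f) (pd2 g) Ω := by
  intro _ hx
  simp only [_root_.pd2, (Filter.eventuallyEq_of_mem (hΩ.mem_nhds hx) h).fderiv_eq]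

lemma Set.EqOn.iterate_pd1 (hΩ : IsOpen Ω) (h : EqOn f g Ω) (j : ℕ) :
    EqOn (_root_.pd1^[j] f) (_root_.pd1^[j] g) Ω := by
  induction j generalizing f g with
  | zero => exact h
  | succ j ih => exact ih (h.pd1 hΩ)

lemma Set.EqOn.iterate_pd2 (hΩ : IsOpen Ω) (h : EqOn f g Ω) (k : ℕ) :
    EqOn (_root_.pd2^[k] f) (_root_.pd2^[k] g) Ω := by
  induction k generalizing f g with
  | zero => exact h
  | succ k ih => exact ih (h.pd2 hΩ)

lemma Set.EqOn.mixedPartial (hΩ : IsOpen Ω) (h : EqOn f g Ω) (j k : ℕ) :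
    EqOn (mixedPartial j k f) (mixedPartial j k g) Ω :=
  (h.iterate_pd2 hΩ k).iterate_pd1 hΩ j

lemma mixedPartial_pd2 (j k : ℕ) (f : ℝ × ℝ → ℝ) :
    mixedPartial j k (pd2 f) = mixedPartial j (k + 1) f := rfl

lemma pd2_pd1_eqOn (hΩ : IsOpen Ω) (hf : ContDiffOn ℝ (⊤ : ℕ∞) f Ω) :
    EqOn (pd2 (pd1 f)) (pd1 (pd2 f)) Ω := fun x hx => by
  have hc := hf.contDiffAt (hΩ.mem_nhds hx)
  have hd : DifferentiableAt ℝ (fderiv ℝ f) x :=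
    (hc.fderiv_right (m := (⊤ : ℕ∞)) (by simp)).differentiableAt (by simp)
  have hs : IsSymmSndFDerivAt ℝ f x := hc.isSymmSndFDerivAt (by
    rw [minSmoothness_of_isRCLikeNormedField]; exact WithTop.coe_le_coe.mpr le_top)
  unfold pd1 pd2
  rw [fderiv_clm_apply hd (differentiableAt_const _), fderiv_clm_apply hd (differentiableAt_const _)]
  simpa using hs.eq _ _

lemma iterate_pd2_pd1_eqOn (hΩ : IsOpen Ω) (hf : ContDiffOn ℝ (⊤ : ℕ∞) f Ω) (k : ℕ) :
    EqOn (pd2^[k] (pd1 f)) (pd1 (pd2^[k] f)) Ω := by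
  induction k generalizing f with
  | zero => exact eqOn_refl _ _
  | succ k ih => exact ((pd2_pd1_eqOn hΩ hf).iterate_pd2 hΩ k).trans (ih (hf.pd2 hΩ))

lemma mixedPartial_pd1_eqOn (hΩ : IsOpen Ω) (hf : ContDiffOn ℝ (⊤ : ℕ∞) f Ω) (j k : ℕ) :
    EqOn (mixedPartial j k (pd1 f)) (mixedPartial (j + 1) k f) Ω :=
  (iterate_pd2_pd1_eqOn hΩ hf k).iterate_pd1 hΩ j

lemma pd1_add_eqOn (hΩ : IsOpen Ω) (hf : ContDiffOn ℝ (⊤ : ℕ∞) f Ω)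
    (hg : ContDiffOn ℝ (⊤ : ℕ∞) g Ω) : EqOn (pd1 (f + g)) (pd1 f + pd1 g) Ω := fun x hx => by
  simp [pd1, fderiv_add (hf.differentiableAt_of_isOpen hΩ hx) (hg.differentiableAt_of_isOpen hΩ hx)]

lemma pd2_add_eqOn (hΩ : IsOpen Ω) (hf : ContDiffOn ℝ (⊤ : ℕ∞) f Ω)
    (hg : ContDiffOn ℝ (⊤ : ℕ∞) g Ω) : EqOn (pd2 (f + g)) (pd2 f + pd2 g) Ω := fun x hx => by
  simp [pd2, fderiv_add (hf.differentiableAt_of_isOpen hΩ hx) (hg.differentiableAt_of_isOpen hΩ hx)]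

lemma mixedPartial_add_eqOn (hΩ : IsOpen Ω) (hf : ContDiffOn ℝ (⊤ : ℕ∞) f Ω)
    (hg : ContDiffOn ℝ (⊤ : ℕ∞) g Ω) (j k : ℕ) :
    EqOn (mixedPartial j k (f + g)) (mixedPartial j k f + mixedPartial j k g) Ω := by
  have h2 : EqOn (pd2^[k] (f + g)) (pd2^[k] f + pd2^[k] g) Ω := by
    induction k generalizing f g with
    | zero => exact eqOn_refl _ _
    | succ k ih =>
      exact ((pd2_add_eqOn hΩ hf hg).iterate_pd2 hΩ k).trans (ih (hf.pd2 hΩ) (hg.pd2 hΩ))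
  refine (h2.iterate_pd1 hΩ j).trans ?_
  have hf' := hf.iterate_pd2 hΩ k
  have hg' := hg.iterate_pd2 hΩ k
  unfold mixedPartial
  generalize pd2^[k] f = F at hf' ⊢
  generalize pd2^[k] g = G at hg' ⊢
  clear h2 hf hg
  induction j generalizing F G with
  | zero => exact eqOn_refl _ _
  | succ j ih =>
    exact ((pd1_add_eqOn hΩ hf' hg').iterate_pd1 hΩ j).trans (ih _ (hf'.pd1 hΩ) _ (hg'.pd1 hΩ))

lemma pd1_neg (f : ℝ × ℝ → ℝ) : pd1 (-f) = -pd1 f := by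
  ext x; simp [pd1, fderiv_neg]

lemma pd2_neg (f : ℝ × ℝ → ℝ) : pd2 (-f) = -pd2 f := by
  ext x; simp [pd2, fderiv_neg]

lemma mixedPartial_neg (j k : ℕ) (f : ℝ × ℝ → ℝ) :
    mixedPartial j k (-f) = -mixedPartial j k f := by
  have h1 : Function.Semiconj (fun f : ℝ × ℝ → ℝ => -f) pd1 pd1 := fun f => (pd1_neg f).symm
  have h2 : Function.Semiconj (fun f : ℝ × ℝ → ℝ => -f) pd2 pd2 := fun f => (pd2_neg f).symm
  exact (congrArg _ (h2.iterate_right k f).symm).trans (h1.iterate_right j _).symm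

lemma pd1_mul_eqOn (hΩ : IsOpen Ω) (hf : ContDiffOn ℝ (⊤ : ℕ∞) f Ω)
    (hg : ContDiffOn ℝ (⊤ : ℕ∞) g Ω) : EqOn (pd1 (f * g)) (f * pd1 g + pd1 f * g) Ω :=
  fun x hx => by
  simp [pd1, mul_comm,
    fderiv_mul (hf.differentiableAt_of_isOpen hΩ hx) (hg.differentiableAt_of_isOpen hΩ hx)]

lemma pd2_mul_eqOn (hΩ : IsOpen Ω) (hf : ContDiffOn ℝ (⊤ : ℕ∞) f Ω)
    (hg : ContDiffOn ℝ (⊤ : ℕ∞) g Ω) : EqOn (pd2 (f * g)) (f * pd2 g + pd2 f * g) Ω :=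
  fun x hx => by
  simp [pd2, mul_comm,
    fderiv_mul (hf.differentiableAt_of_isOpen hΩ hx) (hg.differentiableAt_of_isOpen hΩ hx)]

/-- If `g` vanishes to order `j + k - 1` at `z`, only the term with all derivatives on `g`
survives in the Leibniz rule for `∂^{j+k} (f g) / ∂s^j ∂t^k` at `z`. -/
lemma mixedPartial_mul_of_vanishing (hΩ : IsOpen Ω) {z : ℝ × ℝ} (hz : z ∈ Ω)
    (hf : ContDiffOn ℝ (⊤ : ℕ∞) f Ω) (hg : ContDiffOn ℝ (⊤ : ℕ∞) g Ω) (j k : ℕ)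
    (hvan : ∀ a b : ℕ, a + b < j + k → mixedPartial a b g z = 0) :
    mixedPartial j k (f * g) z = f z * mixedPartial j k g z := by
  have hmul {f g : ℝ × ℝ → ℝ} (hf : ContDiffOn ℝ (⊤ : ℕ∞) f Ω)
      (hg : ContDiffOn ℝ (⊤ : ℕ∞) g Ω) : ContDiffOn ℝ (⊤ : ℕ∞) (f * g) Ω := hf.mul hg
  induction hn : j + k generalizing f g j k with
  | zero =>
    obtain ⟨rfl, rfl⟩ : j = 0 ∧ k = 0 := by omega
    rfl
  | succ n ih =>
    rcases k with _ | k
    · obtain ⟨j, rfl⟩ : ∃ i, j = i + 1 := ⟨j - 1, by omega⟩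
      have hg' := hg.pd1 hΩ
      have hf' := hf.pd1 hΩ
      rw [← mixedPartial_pd1_eqOn hΩ (hmul hf hg) j 0 hz, ← mixedPartial_pd1_eqOn hΩ hg j 0 hz,
        (pd1_mul_eqOn hΩ hf hg).mixedPartial hΩ j 0 hz,
        mixedPartial_add_eqOn hΩ (hmul hf hg') (hmul hf' hg) j 0 hz, Pi.add_apply,
        ih hf hg' j 0 (fun a b hab => by
          rw [mixedPartial_pd1_eqOn hΩ hg a b hz]; exact hvan _ _ (by omega)) (by omega),
        ih hf' hg j 0 (fun a b hab => hvan _ _ (by omega)) (by omega),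
        hvan j 0 (by omega), mul_zero, add_zero]
    · have hg' := hg.pd2 hΩ
      have hf' := hf.pd2 hΩ
      rw [← mixedPartial_pd2, ← mixedPartial_pd2,
        (pd2_mul_eqOn hΩ hf hg).mixedPartial hΩ j k hz,
        mixedPartial_add_eqOn hΩ (hmul hf hg') (hmul hf' hg) j k hz, Pi.add_apply,
        ih hf hg' j k (fun a b hab => by
          rw [mixedPartial_pd2]; exact hvan _ _ (by omega)) (by omega),
        ih hf' hg j k (fun a b hab => hvan _ _ (by omega)) (by omega),
        hvan j k (by omega), mul_zero, add_zero]

end PartialDerivatives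

section HomogeneousPolynomials

open Finset

/-- The binary form of degree `n` with derivative data `a`, where `a j` is the value of
`∂^n / ∂ξ^j ∂η^{n-j}` on it. -/
noncomputable def taylorForm (n : ℕ) (a : ℕ → ℝ) (v : ℝ × ℝ) : ℝ :=
  ∑ j ∈ range (n + 1),
    a j * v.1 ^ j * v.2 ^ (n - j) / (Nat.factorial j * Nat.factorial (n - j))

lemma differentiable_taylorForm (n : ℕ) (a : ℕ → ℝ) : Differentiable ℝ (taylorForm n a) := by
  unfold taylorForm
  fun_prop

lemma pd1_taylorForm (n : ℕ) (a : ℕ → ℝ) (v : ℝ × ℝ) :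
    pd1 (taylorForm (n + 1) a) v = taylorForm n (fun j => a (j + 1)) v := by
  have hline : HasDerivAt (fun x : ℝ => (x, v.2)) ((1 : ℝ), (0 : ℝ)) v.1 :=
    (hasDerivAt_id v.1).prodMk (hasDerivAt_const v.1 v.2)
  have h1 : HasDerivAt (fun x : ℝ => taylorForm (n + 1) a (x, v.2))
      (pd1 (taylorForm (n + 1) a) v) v.1 :=
    HasFDerivAt.comp_hasDerivAt (l := taylorForm (n + 1) a) v.1
      (differentiable_taylorForm (n + 1) a v).hasFDerivAt hline
  refine h1.unique ?_
  unfold taylorForm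
  have h2 : HasDerivAt (fun x : ℝ => ∑ j ∈ range (n + 1 + 1),
      a j * x ^ j * v.2 ^ (n + 1 - j) / (Nat.factorial j * Nat.factorial (n + 1 - j)))
      (∑ j ∈ range (n + 1 + 1), a j * (j * v.1 ^ (j - 1)) * v.2 ^ (n + 1 - j) /
        (Nat.factorial j * Nat.factorial (n + 1 - j))) v.1 :=
    HasDerivAt.fun_sum fun j _ => (((hasDerivAt_pow j v.1).const_mul _).mul_const _).div_const _
  refine h2.congr_deriv ?_
  rw [sum_range_succ']
  simp only [Nat.cast_zero, zero_mul, mul_zero, zero_div, add_zero]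
  refine sum_congr rfl fun j _ => ?_
  rw [Nat.add_sub_add_right n 1 j, Nat.factorial_succ, Nat.add_sub_cancel]
  push_cast
  field_simp

lemma pd2_taylorForm (n : ℕ) (a : ℕ → ℝ) (v : ℝ × ℝ) :
    pd2 (taylorForm (n + 1) a) v = taylorForm n a v := by
  have hline : HasDerivAt (fun x : ℝ => (v.1, x)) ((0 : ℝ), (1 : ℝ)) v.2 :=
    (hasDerivAt_const v.2 v.1).prodMk (hasDerivAt_id v.2)
  have h1 : HasDerivAt (fun x : ℝ => taylorForm (n + 1) a (v.1, x))
      (pd2 (taylorForm (n + 1) a) v) v.2 :=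
    HasFDerivAt.comp_hasDerivAt (l := taylorForm (n + 1) a) v.2
      (differentiable_taylorForm (n + 1) a v).hasFDerivAt hline
  refine h1.unique ?_
  unfold taylorForm
  have h2 : HasDerivAt (fun x : ℝ => ∑ j ∈ range (n + 1 + 1),
      a j * v.1 ^ j * x ^ (n + 1 - j) / (Nat.factorial j * Nat.factorial (n + 1 - j)))
      (∑ j ∈ range (n + 1 + 1), a j * v.1 ^ j * (((n + 1 - j : ℕ) : ℝ) * v.2 ^ (n + 1 - j - 1)) /
        (Nat.factorial j * Nat.factorial (n + 1 - j))) v.2 :=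
    HasDerivAt.fun_sum fun j _ => ((hasDerivAt_pow (n + 1 - j) v.2).const_mul _).div_const _
  refine h2.congr_deriv ?_
  rw [sum_range_succ _ (n + 1)]
  simp only [Nat.sub_self, Nat.cast_zero, zero_mul, mul_zero, zero_div, add_zero]
  refine sum_congr rfl fun j hj => ?_
  rw [Nat.succ_sub (mem_range_succ_iff.mp hj), Nat.factorial_succ, Nat.succ_sub_one]
  push_cast
  field_simp

lemma taylorForm_congr {n : ℕ} {a b : ℕ → ℝ} (h : ∀ j ≤ n, a j = b j) :
    taylorForm n a = taylorForm n b := by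
  ext v
  exact sum_congr rfl fun j hj => by rw [h j (mem_range_succ_iff.mp hj)]

lemma taylorForm_const_mul (n : ℕ) (a : ℕ → ℝ) (r : ℝ) (v : ℝ × ℝ) :
    taylorForm n (fun j => r * a j) v = r * taylorForm n a v := by
  simp only [taylorForm, mul_sum]
  exact sum_congr rfl fun j _ => by ring

/-- A pair of binary forms whose coefficients satisfy the Cauchy–Riemann relations with
constant `r ^ 2` is a multiple of a complex power. -/
lemma taylorForm_add_I_mul_eq_pow (n : ℕ) (a b : ℕ → ℝ) (r : ℝ)
    (h1 : ∀ j < n, r ^ 2 * a (j + 1) = b j) (h2 : ∀ j < n, a j = -b (j + 1)) :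
    ∃ c : ℂ, ∀ ξ η : ℝ,
      (r * taylorForm n a (ξ, η) : ℂ) + Complex.I * (taylorForm n b (ξ, η) : ℂ)
        = c * ((ξ : ℂ) + Complex.I * (r : ℂ) * (η : ℂ)) ^ n := by
  set d : ℕ → ℂ := fun j => r * a j + Complex.I * b j with hd
  have hstep : ∀ j < n, d j = d (j + 1) * (Complex.I * r) := fun j hj => by
    simp only [hd, ← h1 j hj, h2 j hj]
    push_cast
    linear_combination -(r : ℂ) * b (j + 1) * Complex.I_sq
  have hpow : ∀ i ≤ n, d (n - i) = d n * (Complex.I * r) ^ i := fun i => by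
    induction i with
    | zero => simp
    | succ i ih =>
      intro hi
      rw [hstep (n - (i + 1)) (by omega), show n - (i + 1) + 1 = n - i by omega, ih (by omega)]
      ring
  refine ⟨d n / Nat.factorial n, fun ξ η => ?_⟩
  rw [add_pow, mul_sum]
  simp only [taylorForm]
  push_cast
  rw [mul_sum, mul_sum, ← sum_add_distrib]
  refine sum_congr rfl fun j hj => ?_
  have hjn := mem_range_succ_iff.mp hj
  have hdj := hpow (n - j) (Nat.sub_le _ _)
  rw [Nat.sub_sub_self hjn] at hdj
  rw [Nat.cast_choose ℂ hjn]
  have e1 : (Nat.factorial n : ℂ) ≠ 0 := by exact_mod_cast Nat.factorial_ne_zero n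
  have e2 : (Nat.factorial j : ℂ) ≠ 0 := by exact_mod_cast Nat.factorial_ne_zero j
  have e3 : (Nat.factorial (n - j) : ℂ) ≠ 0 := by exact_mod_cast Nat.factorial_ne_zero (n - j)
  trans d j * ξ ^ j * η ^ (n - j) / (Nat.factorial j * Nat.factorial (n - j))
  · simp only [hd]; ring
  · rw [hdj, mul_pow (Complex.I * (r : ℂ))]
    field_simp

end HomogeneousPolynomials

/-- if smooth `u, w` solve the reduced special Lagrangian system and
vanish (resp. `w - c` vanishes) to order `m - 1` at `z₀`, then their degree-`m`
homogeneous Taylor polynomials `p, q` at `z₀` solve the frozen-coefficient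
Cauchy–Riemann system `V(z₀)·∂p/∂ξ = ∂q/∂η`, `∂p/∂η = −∂q/∂ξ`, and hence
`√(V(z₀))·p + i·q = c′·(ξ + i·√(V(z₀))·η)^m` for some `c′ ∈ ℂ`. -/
theorem taylor_leading_part_is_complex_power
    (Ω : Set (ℝ × ℝ)) (hΩ : IsOpen Ω) (z₀ : ℝ × ℝ) (hz₀ : z₀ ∈ Ω)
    (V u w : ℝ × ℝ → ℝ)
    (hV : ContDiffOn ℝ (⊤ : ℕ∞) V Ω) (hVpos : 0 < V z₀)
    (hu : ContDiffOn ℝ (⊤ : ℕ∞) u Ω) (hw : ContDiffOn ℝ (⊤ : ℕ∞) w Ω)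
    (hsys : ∀ x ∈ Ω, V x * pd1 u x = pd2 w x ∧ pd2 u x = - pd1 w x)
    (m : ℕ) (hm : 1 ≤ m) (c : ℝ) (hc : c = w z₀)
    (hvu : ∀ j k : ℕ, j + k ≤ m - 1 → mixedPartial j k u z₀ = 0)
    (hvw : ∀ j k : ℕ, j + k ≤ m - 1 → mixedPartial j k (fun x => w x - c) z₀ = 0)
    (p q : ℝ × ℝ → ℝ)
    (hp : ∀ ξ η : ℝ, p (ξ, η) = ∑ j ∈ Finset.range (m + 1),
      mixedPartial j (m - j) u z₀ * ξ ^ j * η ^ (m - j)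
        / (Nat.factorial j * Nat.factorial (m - j)))
    (hq : ∀ ξ η : ℝ, q (ξ, η) = ∑ j ∈ Finset.range (m + 1),
      mixedPartial j (m - j) (fun x => w x - c) z₀ * ξ ^ j * η ^ (m - j)
        / (Nat.factorial j * Nat.factorial (m - j))) :
    (∀ v : ℝ × ℝ,
        V z₀ * fderiv ℝ p v (1, 0) = fderiv ℝ q v (0, 1) ∧
        fderiv ℝ p v (0, 1) = - fderiv ℝ q v (1, 0)) ∧
    ∃ c' : ℂ, ∀ ξ η : ℝ,
      (Real.sqrt (V z₀) * p (ξ, η) : ℂ) + Complex.I * (q (ξ, η) : ℂ)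
        = c' * ((ξ : ℂ) + Complex.I * (Real.sqrt (V z₀) : ℂ) * (η : ℂ)) ^ m := by
  obtain ⟨n, rfl⟩ : ∃ n, m = n + 1 := ⟨m - 1, by omega⟩
  rw [Nat.add_sub_cancel] at hvu hvw
  set W : ℝ × ℝ → ℝ := fun x => w x - c
  have hW : ContDiffOn ℝ (⊤ : ℕ∞) W Ω := hw.sub contDiffOn_const
  have hW1 : pd1 W = pd1 w := by ext x; simp only [pd1, W, fderiv_sub_const]
  have hW2 : pd2 W = pd2 w := by ext x; simp only [pd2, W, fderiv_sub_const]
  have hsys1 : Set.EqOn (V * pd1 u) (pd2 W) Ω := fun x hx => by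
    rw [hW2]; exact (hsys x hx).1
  have hsys2 : Set.EqOn (pd2 u) (-pd1 W) Ω := fun x hx => by
    rw [hW1]; exact (hsys x hx).2
  set a : ℕ → ℝ := fun j => mixedPartial j (n + 1 - j) u z₀
  set b : ℕ → ℝ := fun j => mixedPartial j (n + 1 - j) W z₀
  have hab1 : ∀ j ≤ n, V z₀ * a (j + 1) = b j := fun j hj => by
    simp only [a, b]
    rw [Nat.add_sub_add_right, Nat.succ_sub hj, Nat.succ_eq_add_one, ← mixedPartial_pd2,
      ← hsys1.mixedPartial hΩ j (n - j) hz₀,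
      mixedPartial_mul_of_vanishing hΩ hz₀ hV (hu.pd1 hΩ) j (n - j) (fun i k hik => by
        rw [mixedPartial_pd1_eqOn hΩ hu i k hz₀]; exact hvu _ _ (by omega)),
      mixedPartial_pd1_eqOn hΩ hu j (n - j) hz₀]
  have hab2 : ∀ j ≤ n, a j = -b (j + 1) := fun j hj => by
    simp only [a, b]
    rw [Nat.add_sub_add_right, Nat.succ_sub hj, Nat.succ_eq_add_one, ← mixedPartial_pd2,
      hsys2.mixedPartial hΩ j (n - j) hz₀, mixedPartial_neg, Pi.neg_apply,
      mixedPartial_pd1_eqOn hΩ hW j (n - j) hz₀]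
  obtain rfl : p = taylorForm (n + 1) a := funext fun v => hp v.1 v.2
  obtain rfl : q = taylorForm (n + 1) b := funext fun v => hq v.1 v.2
  refine ⟨fun v => ⟨?_, ?_⟩, ?_⟩
  · change V z₀ * pd1 _ v = pd2 _ v
    rw [pd1_taylorForm, pd2_taylorForm, ← taylorForm_const_mul, taylorForm_congr hab1]
  · change pd2 _ v = -pd1 _ v
    rw [pd1_taylorForm, pd2_taylorForm, neg_eq_neg_one_mul, ← taylorForm_const_mul]
    exact congrFun (taylorForm_congr fun j hj => by rw [hab2 j hj, neg_one_mul]) v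
  · refine taylorForm_add_I_mul_eq_pow (n + 1) a b _ ?_ ?_
    · intro j hj
      rw [Real.sq_sqrt hVpos.le, hab1 j (by omega)]
    · exact fun j hj => hab2 j (by omega)
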